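/- Let 0 < α < 2, let φ : [0,1) → ℝ be continuously differentiable with φ(0) = 0, and let ψ : [0,1) → ℝ be continuous. If ∫_0^t (t²−s²)^{α/2−1} ψ(s) ds = φ(t) for every t ∈ (0,1), then ψ(t) = (2 sin(απ/2)/π) · t · ∫_0^t φ′(s) (t²−s²)^{−α/2} ds for every t ∈ (0,1). -/

import Mathlib

open MeasureTheory Real Filter Topology Metric Set

noncomputable section

abbrev EN (N : ℕ) := EuclideanSpace ℝ (Fin N)

/-- The normalizing constant `c_{N,α}` of the fractional Laplacian. -/
def fracLapCoeff (N : ℕ) (α : ℝ) : ℝ :=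
  2 ^ α * Real.pi ^ (-(N : ℝ) / 2) * Real.Gamma (((N : ℝ) + α) / 2) / |Real.Gamma (-α / 2)|

/-- `HasFracLap N α u x L` means the principal-value limit defining `Δ^{α/2} u (x)` exists
and equals `L`. -/
def HasFracLap (N : ℕ) (α : ℝ) (u : EN N → ℝ) (x : EN N) (L : ℝ) : Prop :=
  Tendsto (fun ε : ℝ =>
      fracLapCoeff N α * ∫ y in {y : EN N | ε < dist y x}, (u y - u x) / dist y x ^ ((N : ℝ) + α))
    (𝓝[>] (0 : ℝ)) (𝓝 L)

/-- The value of the fractional Laplacian at `x` (junk value `0` where the limit fails). -/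
def fracLap (N : ℕ) (α : ℝ) (u : EN N → ℝ) (x : EN N) : ℝ :=
  haveI := Classical.propDecidable (∃ L, HasFracLap N α u x L)
  if h : ∃ L, HasFracLap N α u x L then h.choose else 0

/-- The weighted space `𝓛_α`. -/
def memLalpha (N : ℕ) (α : ℝ) (u : EN N → ℝ) : Prop :=
  Integrable (fun y : EN N => u y * (1 + ‖y‖) ^ (-((N : ℝ) + α)))

/-- `δ(x) = 1 - |x|` on the unit ball, `0` outside. -/
def delta1 {N : ℕ} (x : EN N) : ℝ := if ‖x‖ < 1 then 1 - ‖x‖ else 0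

/-- The constant `κ_{N,α}`. -/
def greenCoeff (N : ℕ) (α : ℝ) : ℝ :=
  Real.Gamma ((N : ℝ) / 2) / (2 ^ α * Real.pi ^ ((N : ℝ) / 2) * Real.Gamma (α / 2) ^ 2)

/-- The Green function of the unit ball. -/
def greenB (N : ℕ) (α : ℝ) (x y : EN N) : ℝ :=
  if ‖x‖ < 1 ∧ ‖y‖ < 1 then
    greenCoeff N α * ‖x - y‖ ^ (α - (N : ℝ)) *
      ∫ s in (0:ℝ)..((1 - ‖x‖ ^ 2) * (1 - ‖y‖ ^ 2) / ‖x - y‖ ^ 2),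
        s ^ (α / 2 - 1) * (1 + s) ^ (-(N : ℝ) / 2)
  else 0

/-- The Green function of the ball `B(a,r)`, by scaling. -/
def greenBall (N : ℕ) (α : ℝ) (a : EN N) (r : ℝ) (x y : EN N) : ℝ :=
  r ^ (α - (N : ℝ)) * greenB N α (r⁻¹ • (x - a)) (r⁻¹ • (y - a))

/-- The constant `c_α^N` of the Poisson kernel. -/
def poissonCoeff (N : ℕ) (α : ℝ) : ℝ :=
  Real.pi ^ (-1 - (N : ℝ) / 2) * Real.Gamma ((N : ℝ) / 2) * Real.sin (Real.pi * α / 2)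

/-- The Poisson kernel of the ball `B(a,r)`. -/
def poissonBall (N : ℕ) (α : ℝ) (a : EN N) (r : ℝ) (x y : EN N) : ℝ :=
  poissonCoeff N α * ((r ^ 2 - ‖x - a‖ ^ 2) / (‖y - a‖ ^ 2 - r ^ 2)) ^ (α / 2) *
    ‖x - y‖ ^ (-(N : ℝ))

/-- The harmonic-measure operator `H^α_{B(a,r)} f`. -/
def Hball (N : ℕ) (α : ℝ) (a : EN N) (r : ℝ) (f : EN N → ℝ) (x : EN N) : ℝ :=
  ∫ y in {y : EN N | r < ‖y - a‖}, poissonBall N α a r x y * f y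

/-- Solution (in the distributional sense) of `Δ^{α/2} u = u^γ` in the open set `U`. -/
def IsSolution (N : ℕ) (α γ : ℝ) (U : Set (EN N)) (u : EN N → ℝ) : Prop :=
  (∀ x, 0 ≤ u x) ∧ ContinuousOn u U ∧ memLalpha N α u ∧
    ∀ φ : EN N → ℝ, ContDiff ℝ (⊤ : ℕ∞) φ → HasCompactSupport φ → tsupport φ ⊆ U →
      (∀ x, 0 ≤ φ x) →
        ∫ x, u x * fracLap N α φ x = ∫ x, u x ^ γ * φ x

/-- The surface measure `σ` on the unit sphere. -/
def sphereMeasure (N : ℕ) : Measure (Metric.sphere (0 : EN N) 1) :=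
  (volume : Measure (EN N)).toSphere

/-- The Martin integral `M_B^α g`. -/
def martinB (N : ℕ) (α : ℝ) (g : Metric.sphere (0 : EN N) 1 → ℝ) (x : EN N) : ℝ :=
  if ‖x‖ < 1 then
    ∫ y, (1 - ‖x‖ ^ 2) ^ (α / 2) * ‖x - (y : EN N)‖ ^ (-(N : ℝ)) * g y ∂(sphereMeasure N)
  else 0

/-- Solution of the moderate blow-up problem `(P_g)`. -/
def IsSolutionPg (N : ℕ) (α γ : ℝ) (g : Metric.sphere (0 : EN N) 1 → ℝ) (u : EN N → ℝ) : Prop :=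
  (∀ x, 0 ≤ u x) ∧ memLalpha N α u ∧ (∀ x : EN N, ¬ ‖x‖ < 1 → u x = 0) ∧
    IsSolution N α γ (Metric.ball (0 : EN N) 1) u ∧
    ∀ z : Metric.sphere (0 : EN N) 1,
      Tendsto (fun x => delta1 x ^ (1 - α / 2) * u x)
        (𝓝[Metric.ball (0 : EN N) 1] (z : EN N)) (𝓝 (g z))

/-- Solution of the blow-up problem `(P_∞)`. -/
def IsSolutionPinf (N : ℕ) (α γ : ℝ) (u : EN N → ℝ) : Prop :=
  (∀ x, 0 ≤ u x) ∧ memLalpha N α u ∧ (∀ x : EN N, ¬ ‖x‖ < 1 → u x = 0) ∧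
    IsSolution N α γ (Metric.ball (0 : EN N) 1) u ∧
    ∀ z : Metric.sphere (0 : EN N) 1,
      Tendsto (fun x => delta1 x ^ (1 - α / 2) * u x)
        (𝓝[Metric.ball (0 : EN N) 1] (z : EN N)) atTop

lemma aux_beta (p q : ℝ) (hp : 0 < p) (hq : 0 < q) :
    IntegrableOn (fun x : ℝ => (1 - x) ^ (p - 1) * x ^ (q - 1)) (Ioo 0 1) ∧
    ∫ x in Ioo (0:ℝ) 1, (1 - x) ^ (p - 1) * x ^ (q - 1) = ProbabilityTheory.beta p q := by
  have hconv := Complex.betaIntegral_convergent (u := (q:ℂ)) (v := (p:ℂ)) (by simpa) (by simpa)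
  have hcongr : ∀ x ∈ Ioo (0:ℝ) 1, (x:ℂ) ^ ((q:ℂ) - 1) * (1 - (x:ℂ)) ^ ((p:ℂ) - 1) =
      (((1 - x) ^ (p - 1) * x ^ (q - 1) : ℝ) : ℂ) := by
    intro x hx
    push_cast
    rw [Complex.ofReal_cpow (by linarith [hx.2]), Complex.ofReal_cpow (by linarith [hx.1])]
    push_cast
    ring
  rw [intervalIntegrable_iff_integrableOn_Ioo_of_le zero_le_one] at hconv
  have hi : IntegrableOn (fun x : ℝ => (((1 - x) ^ (p - 1) * x ^ (q - 1) : ℝ) : ℂ)) (Ioo 0 1) :=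
    hconv.congr_fun hcongr measurableSet_Ioo
  have hi' : IntegrableOn (fun x : ℝ => (1 - x) ^ (p - 1) * x ^ (q - 1)) (Ioo 0 1) := hi.re
  refine ⟨hi', ?_⟩
  have hsymm : ProbabilityTheory.beta p q = ProbabilityTheory.beta q p := by
    unfold ProbabilityTheory.beta; rw [mul_comm, add_comm]
  rw [hsymm, ProbabilityTheory.beta_eq_betaIntegralReal q p hq hp, Complex.betaIntegral,
    intervalIntegral.integral_of_le zero_le_one, integral_Ioc_eq_integral_Ioo,
    setIntegral_congr_fun measurableSet_Ioo hcongr, integral_complex_ofReal, Complex.ofReal_re]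

lemma aux_kernel (p q s t : ℝ) (hp : 0 < p) (hq : 0 < q) (hs : 0 ≤ s) (hst : s < t) :
    IntegrableOn (fun r : ℝ => r * (t ^ 2 - r ^ 2) ^ (p - 1) * (r ^ 2 - s ^ 2) ^ (q - 1)) (Ioo s t) ∧
    ∫ r in Ioo s t, r * (t ^ 2 - r ^ 2) ^ (p - 1) * (r ^ 2 - s ^ 2) ^ (q - 1) =
      ProbabilityTheory.beta p q / 2 * (t ^ 2 - s ^ 2) ^ (p + q - 1) := by
  obtain ⟨h1, h2⟩ := aux_beta p q hp hq
  set D := t ^ 2 - s ^ 2 with hD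
  have hDpos : 0 < D := by rw [hD]; nlinarith
  set f : ℝ → ℝ := fun r => (r ^ 2 - s ^ 2) / D with hf
  have hder : ∀ x ∈ Ioo s t, HasDerivWithinAt f (2 * x / D) (Ioo s t) x := by
    intro x _
    have := (((hasDerivAt_id x).pow 2).sub_const (s ^ 2)).div_const D
    simpa using this.hasDerivWithinAt
  have hinj : InjOn f (Ioo s t) := by
    intro x hx y hy hxy
    simp only [hf] at hxy
    rw [div_left_inj' hDpos.ne'] at hxy
    have hx0 : 0 < x := lt_of_le_of_lt hs hx.1
    have hy0 : 0 < y := lt_of_le_of_lt hs hy.1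
    nlinarith
  have himg : f '' (Ioo s t) = Ioo 0 1 := by
    ext y
    constructor
    · rintro ⟨x, hx, rfl⟩
      have hx0 : 0 < x := lt_of_le_of_lt hs hx.1
      refine ⟨div_pos (by nlinarith [hx.1]) hDpos, ?_⟩
      rw [div_lt_one hDpos, hD]
      nlinarith [hx.2]
    · intro hy
      have hsq : s ^ 2 < s ^ 2 + y * D := by nlinarith [mul_pos hy.1 hDpos]
      have hlt : s ^ 2 + y * D < t ^ 2 := by nlinarith [mul_lt_mul_of_pos_right hy.2 hDpos]
      refine ⟨√(s ^ 2 + y * D), ⟨Real.lt_sqrt_of_sq_lt hsq, ?_⟩, ?_⟩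
      · rw [Real.sqrt_lt' (lt_of_le_of_lt hs hst)]; exact hlt
      · simp only [hf]
        rw [Real.sq_sqrt (by nlinarith [sq_nonneg s])]
        field_simp
        ring
  have hcongr : ∀ r ∈ Ioo s t, |2 * r / D| • ((1 - f r) ^ (p - 1) * (f r) ^ (q - 1)) =
      (2 / D ^ (p + q - 1)) * (r * (t ^ 2 - r ^ 2) ^ (p - 1) * (r ^ 2 - s ^ 2) ^ (q - 1)) := by
    intro r hr
    have hr0 : 0 < r := lt_of_le_of_lt hs hr.1
    have e1 : 1 - f r = (t ^ 2 - r ^ 2) / D := by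
      simp only [hf]; field_simp; rw [hD]; ring
    rw [e1]
    simp only [hf]
    rw [Real.div_rpow (by nlinarith [hr.2]) hDpos.le, Real.div_rpow (by nlinarith [hr.1]) hDpos.le,
      abs_of_pos (by positivity)]
    have e2 : D ^ (p + q - 1) = D * D ^ (p - 1) * D ^ (q - 1) := by
      rw [← Real.rpow_one_add' hDpos.le (by linarith), ← Real.rpow_add hDpos]
      congr 1; ring
    rw [e2, smul_eq_mul]
    have := Real.rpow_pos_of_pos hDpos (p - 1)
    have := Real.rpow_pos_of_pos hDpos (q - 1)
    field_simp
  have hne : (2 / D ^ (p + q - 1)) ≠ 0 := by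
    have := Real.rpow_pos_of_pos hDpos (p + q - 1)
    positivity
  rw [← himg] at h1 h2
  rw [integrableOn_image_iff_integrableOn_abs_deriv_smul measurableSet_Ioo hder hinj] at h1
  rw [integral_image_eq_integral_abs_deriv_smul measurableSet_Ioo hder hinj] at h2
  rw [setIntegral_congr_fun measurableSet_Ioo hcongr, integral_const_mul] at h2
  have h1' := h1.congr_fun hcongr measurableSet_Ioo
  refine ⟨?_, ?_⟩
  · have := h1'.const_mul (2 / D ^ (p + q - 1))⁻¹
    refine this.congr (Eventually.of_forall fun r => ?_)
    simp only
    rw [inv_mul_cancel_left₀ hne]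
  · rw [← h2]
    have := Real.rpow_pos_of_pos hDpos (p + q - 1)
    field_simp

lemma aux_fubini (p q t : ℝ) (hp : 0 < p) (hq : 0 < q) (hpq : 1 ≤ p + q) (ht : 0 < t)
    (f : ℝ → ℝ) (hf : ContinuousOn f (Icc 0 t)) :
    ∫ r in (0:ℝ)..t, r * (t ^ 2 - r ^ 2) ^ (p - 1) *
        ∫ s in (0:ℝ)..r, (r ^ 2 - s ^ 2) ^ (q - 1) * f s =
      ProbabilityTheory.beta p q / 2 * ∫ s in (0:ℝ)..t, (t ^ 2 - s ^ 2) ^ (p + q - 1) * f s := by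
  set K : ℝ → ℝ → ℝ := fun r s => r * (t ^ 2 - r ^ 2) ^ (p - 1) * (r ^ 2 - s ^ 2) ^ (q - 1) with hK
  set T : Set (ℝ × ℝ) := {z | z.2 < z.1} with hT
  set G : ℝ → ℝ → ℝ := fun r s => (Iio r).indicator (fun s => K r s * f s) s with hG
  set μ := volume.restrict (Ioo 0 t) with hμ
  have hTm : MeasurableSet T := measurableSet_lt measurable_snd measurable_fst
  have hGT : Function.uncurry G = T.indicator (fun z => K z.1 z.2 * f z.2) := by
    ext ⟨r, s⟩
    simp [hG, hT, indicator, Function.uncurry]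
  have hfm : AEStronglyMeasurable f μ :=
    (hf.mono Ioo_subset_Icc_self).aestronglyMeasurable measurableSet_Ioo
  have hmeas : AEStronglyMeasurable (Function.uncurry G) (μ.prod μ) := by
    rw [hGT]
    refine AEStronglyMeasurable.indicator ?_ hTm
    refine AEStronglyMeasurable.mul ?_ hfm.comp_snd
    apply Measurable.aestronglyMeasurable
    simp only [hK]
    fun_prop
  have hG' : ∀ s, (fun r => G r s) = (Ioi s).indicator (fun r => K r s * f s) := by
    intro s
    ext r
    simp [hG, indicator]
  have hinter : ∀ s ∈ Ioo 0 t, Ioi s ∩ Ioo 0 t = Ioo s t := by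
    intro s hs
    ext r
    simp only [mem_inter_iff, mem_Ioi, mem_Ioo]
    constructor
    · rintro ⟨a, b, c⟩; exact ⟨a, c⟩
    · rintro ⟨a, c⟩; exact ⟨a, hs.1.trans a, c⟩
  have hinter' : ∀ r ∈ Ioo 0 t, Iio r ∩ Ioo 0 t = Ioo 0 r := by
    intro r hr
    ext s
    simp only [mem_inter_iff, mem_Iio, mem_Ioo]
    constructor
    · rintro ⟨a, b, c⟩; exact ⟨b, a⟩
    · rintro ⟨a, c⟩; exact ⟨c, a, c.trans hr.2⟩
  have hGint : ∀ s ∈ Ioo 0 t, ∫ r, G r s ∂μ =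
      ProbabilityTheory.beta p q / 2 * ((t ^ 2 - s ^ 2) ^ (p + q - 1) * f s) := by
    intro s hs
    rw [hG' s, integral_indicator measurableSet_Ioi, hμ, Measure.restrict_restrict measurableSet_Ioi,
      hinter s hs, integral_mul_const, (aux_kernel p q s t hp hq hs.1.le hs.2).2]
    ring
  have hGn : ∀ s ∈ Ioo 0 t, ∫ r, ‖G r s‖ ∂μ =
      ProbabilityTheory.beta p q / 2 * ((t ^ 2 - s ^ 2) ^ (p + q - 1) * |f s|) := by
    intro s hs
    have : (fun r => ‖G r s‖) = (Ioi s).indicator (fun r => ‖K r s * f s‖) := by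
      ext r
      simp only [hG, indicator, mem_Iio, mem_Ioi]
      split_ifs <;> simp
    rw [this, integral_indicator measurableSet_Ioi, hμ, Measure.restrict_restrict measurableSet_Ioi,
      hinter s hs]
    have hc : ∀ r ∈ Ioo s t, ‖K r s * f s‖ = K r s * |f s| := by
      intro r hr
      rw [norm_mul, Real.norm_eq_abs, Real.norm_eq_abs, abs_of_nonneg]
      have hr0 : 0 < r := hs.1.trans hr.1
      have := hs.1
      have h1 : 0 ≤ t ^ 2 - r ^ 2 := by nlinarith [hr.2]
      have h2 : 0 ≤ r ^ 2 - s ^ 2 := by nlinarith [hr.1]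
      simp only [hK]
      positivity
    rw [setIntegral_congr_fun measurableSet_Ioo hc,
      integral_mul_const, (aux_kernel p q s t hp hq hs.1.le hs.2).2]
    ring
  have hint : Integrable (Function.uncurry G) (μ.prod μ) := by
    rw [integrable_prod_iff' hmeas]
    refine ⟨?_, ?_⟩
    · refine ae_restrict_of_forall_mem measurableSet_Ioo fun s hs => ?_
      change Integrable (fun r => G r s) μ
      rw [hG' s, integrable_indicator_iff measurableSet_Ioi, hμ, IntegrableOn,
        Measure.restrict_restrict measurableSet_Ioi, hinter s hs]
      exact (aux_kernel p q s t hp hq hs.1.le hs.2).1.mul_const _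
    · change Integrable (fun s => ∫ r, ‖G r s‖ ∂μ) μ
      have hc : ContinuousOn (fun s => ProbabilityTheory.beta p q / 2 *
          ((t ^ 2 - s ^ 2) ^ (p + q - 1) * |f s|)) (Icc 0 t) := by
        refine continuousOn_const.mul (ContinuousOn.mul ?_ hf.abs)
        exact ContinuousOn.rpow_const (by fun_prop) (fun x _ => Or.inr (by linarith))
      have := (hc.integrableOn_Icc (μ := volume)).mono_set Ioo_subset_Icc_self
      exact this.congr_fun (fun s hs => (hGn s hs).symm) measurableSet_Ioo
  have hswap := integral_integral_swap hint
  rw [setIntegral_congr_fun measurableSet_Ioo hGint, integral_const_mul] at hswap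
  rw [intervalIntegral.integral_of_le ht.le, intervalIntegral.integral_of_le ht.le,
    integral_Ioc_eq_integral_Ioo, integral_Ioc_eq_integral_Ioo, ← hswap]
  refine setIntegral_congr_fun measurableSet_Ioo fun r hr => ?_
  change _ = ∫ s, G r s ∂μ
  rw [intervalIntegral.integral_of_le hr.1.le, integral_Ioc_eq_integral_Ioo, ← integral_const_mul]
  simp only [hG]
  rw [integral_indicator measurableSet_Iio, hμ, Measure.restrict_restrict measurableSet_Iio,
      hinter' r hr]
  congr 1
  ext s
  simp only [hK]
  ring

lemma aux_cont (β T : ℝ) (hβ0 : 0 < β) (hβ1 : β < 1) (hT : 0 < T) (g : ℝ → ℝ)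
    (hg : ContinuousOn g (Icc 0 T)) :
    ContinuousOn (fun t => t * ∫ s in (0:ℝ)..t, (t ^ 2 - s ^ 2) ^ (-β) * g s) (Icc 0 T) := by
  set e : ℝ → ℝ := IccExtend hT.le ((Icc 0 T).restrict g) with he
  have hec : Continuous e := (continuousOn_iff_continuous_restrict.mp hg).Icc_extend'
  have heg : ∀ x ∈ Icc 0 T, e x = g x := fun x hx => by
    rw [he, IccExtend_of_mem _ _ hx]; rfl
  obtain ⟨C, hC⟩ := isCompact_Icc.exists_bound_of_continuousOn hg
  have hCe : ∀ x, ‖e x‖ ≤ C := fun x => hC _ (projIcc 0 T hT.le x).2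
  have hJ : Continuous fun t : ℝ => ∫ x in (0:ℝ)..1, (1 - x ^ 2) ^ (-β) * e (t * x) := by
    refine intervalIntegral.continuous_of_dominated_interval
      (bound := fun x => (1 - x) ^ (-β) * C) ?_ ?_ ?_ ?_
    · intro t
      have : Measurable e := hec.measurable
      apply Measurable.aestronglyMeasurable
      fun_prop
    · intro t
      refine Eventually.of_forall fun x hx => ?_
      rw [uIoc_of_le zero_le_one] at hx
      rw [norm_mul]
      refine mul_le_mul ?_ (hCe _) (norm_nonneg _) (Real.rpow_nonneg (by linarith [hx.2]) _)
      rw [Real.norm_eq_abs, abs_of_nonneg (Real.rpow_nonneg (by nlinarith [hx.1, hx.2]) _)]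
      rcases eq_or_lt_of_le hx.2 with h | h
      · rw [h]; norm_num
      · refine Real.rpow_le_rpow_of_nonpos (by linarith) (by nlinarith [hx.1]) (by linarith)
    · have := (aux_beta (1 - β) 1 (by linarith) one_pos).1
      rw [intervalIntegrable_iff_integrableOn_Ioo_of_le zero_le_one]
      refine Integrable.mul_const ?_ C
      refine this.congr_fun (fun x _ => ?_) measurableSet_Ioo
      simp
    · refine Eventually.of_forall fun x _ => ?_
      fun_prop
  have hF : Continuous fun t : ℝ => t ^ (2 - 2 * β) *
      ∫ x in (0:ℝ)..1, (1 - x ^ 2) ^ (-β) * e (t * x) :=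
    (Real.continuous_rpow_const (by linarith)).mul hJ
  refine hF.continuousOn.congr fun t ht => ?_
  simp only
  rcases eq_or_lt_of_le ht.1 with h | h
  · rw [← h, Real.zero_rpow (by linarith)]; simp
  · have h1 := intervalIntegral.mul_integral_comp_mul_left (a := 0) (b := 1)
      (f := fun s => (t ^ 2 - s ^ 2) ^ (-β) * g s) t
    rw [mul_zero, mul_one] at h1
    rw [← h1]
    have h2 : ∫ x in (0:ℝ)..1, (t ^ 2 - (t * x) ^ 2) ^ (-β) * g (t * x) =
        ∫ x in (0:ℝ)..1, t ^ (-(2 * β)) * ((1 - x ^ 2) ^ (-β) * e (t * x)) := by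
      refine intervalIntegral.integral_congr fun x hx => ?_
      rw [uIcc_of_le zero_le_one] at hx
      rw [heg (t * x) ⟨mul_nonneg h.le hx.1, by nlinarith [hx.2, ht.2, hx.1]⟩]
      have : t ^ 2 - (t * x) ^ 2 = t ^ 2 * (1 - x ^ 2) := by ring
      rw [this, Real.mul_rpow (by positivity) (by nlinarith [hx.1, hx.2]), ← Real.rpow_natCast t 2,
        ← Real.rpow_mul h.le]
      push_cast
      rw [mul_neg]
      ring
    rw [h2, intervalIntegral.integral_const_mul]
    have h3 : t ^ (2 - 2 * β) = t * t * t ^ (-(2 * β)) := by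
      rw [sub_eq_add_neg, Real.rpow_add h, Real.rpow_two]; ring
    rw [h3]; ring

/-- inversion of the one-dimensional fractional integral equation. -/
theorem statement_16 (α : ℝ) (hα0 : 0 < α) (hα2 : α < 2)
    (φ φ' ψ : ℝ → ℝ) (hφ0 : φ 0 = 0)
    (hφd : ∀ t ∈ Set.Ico (0 : ℝ) 1, HasDerivAt φ (φ' t) t)
    (hφ'c : ContinuousOn φ' (Set.Ico (0 : ℝ) 1))
    (hψc : ContinuousOn ψ (Set.Ico (0 : ℝ) 1))
    (heq : ∀ t ∈ Set.Ioo (0 : ℝ) 1,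
      ∫ s in (0 : ℝ)..t, (t ^ 2 - s ^ 2) ^ (α / 2 - 1) * ψ s = φ t) :
    ∀ t ∈ Set.Ioo (0 : ℝ) 1,
      ψ t = (2 * Real.sin (α * Real.pi / 2) / Real.pi) * t *
        ∫ s in (0 : ℝ)..t, φ' s * (t ^ 2 - s ^ 2) ^ (-(α / 2)) := by
  have hβ0 : 0 < α / 2 := by linarith
  have hβ1 : α / 2 < 1 := by linarith
  set β := α / 2 with hβ
  have hπ : α * π / 2 = π * β := by rw [hβ]; ring
  have hsin : 0 < Real.sin (π * β) := by
    apply Real.sin_pos_of_pos_of_lt_pi <;> nlinarith [Real.pi_pos]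
  have hB : ProbabilityTheory.beta (1 - β) β = π / Real.sin (π * β) := by
    unfold ProbabilityTheory.beta
    rw [sub_add_cancel, Real.Gamma_one, div_one, mul_comm, Real.Gamma_mul_Gamma_one_sub]
  have hBsymm : ProbabilityTheory.beta (1 - β) 1 = ProbabilityTheory.beta 1 (1 - β) := by
    unfold ProbabilityTheory.beta; rw [mul_comm, add_comm]
  set H : ℝ → ℝ := fun t => t * ∫ s in (0:ℝ)..t, (t ^ 2 - s ^ 2) ^ (-β) * φ' s with hH
  set c : ℝ := 2 * Real.sin (π * β) / π with hc
  have hsub : ∀ t < 1, Icc (0:ℝ) t ⊆ Ico 0 1 := fun t ht x hx => ⟨hx.1, hx.2.trans_lt ht⟩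
  have key : ∀ t ∈ Ioo (0:ℝ) 1, ∫ s in (0:ℝ)..t, ψ s = ∫ s in (0:ℝ)..t, c * H s := by
    intro t ht
    have k1 := aux_fubini (1 - β) β t (by linarith) hβ0 (by linarith) ht.1 ψ
      (hψc.mono (hsub t ht.2))
    have k2 := aux_fubini (1 - β) 1 t (by linarith) one_pos (by linarith) ht.1 φ'
      (hφ'c.mono (hsub t ht.2))
    have k3 := aux_fubini 1 (1 - β) t one_pos (by linarith) (by linarith) ht.1 φ'
      (hφ'c.mono (hsub t ht.2))
    rw [← hBsymm, add_comm 1 (1 - β), ← k2] at k3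
    have e1 : ∫ r in (0:ℝ)..t, r * (t ^ 2 - r ^ 2) ^ (1 - β - 1) *
          ∫ s in (0:ℝ)..r, (r ^ 2 - s ^ 2) ^ (β - 1) * ψ s =
        ∫ r in (0:ℝ)..t, r * (t ^ 2 - r ^ 2) ^ (1 - β - 1) *
          ∫ s in (0:ℝ)..r, (r ^ 2 - s ^ 2) ^ ((1:ℝ) - 1) * φ' s := by
      refine intervalIntegral.integral_congr fun r hr => ?_
      rw [uIcc_of_le ht.1.le] at hr
      rcases eq_or_lt_of_le hr.1 with h | h
      · rw [← h]; simp
      · have hr1 : r < 1 := hr.2.trans_lt ht.2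
        rw [heq r ⟨h, hr1⟩]
        simp only [sub_self, Real.rpow_zero, one_mul]
        rw [intervalIntegral.integral_eq_sub_of_hasDerivAt (f := φ), hφ0, sub_zero]
        · intro x hx
          rw [uIcc_of_le h.le] at hx
          exact hφd x (hsub r hr1 hx)
        · apply ContinuousOn.intervalIntegrable
          rw [uIcc_of_le h.le]
          exact hφ'c.mono (hsub r hr1)
    have e2 : ∫ r in (0:ℝ)..t, r * (t ^ 2 - r ^ 2) ^ ((1:ℝ) - 1) *
          ∫ s in (0:ℝ)..r, (r ^ 2 - s ^ 2) ^ (1 - β - 1) * φ' s = ∫ r in (0:ℝ)..t, H r := by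
      refine intervalIntegral.integral_congr fun r hr => ?_
      simp only [hH, sub_self, Real.rpow_zero, mul_one]
      rw [show 1 - β - 1 = -β by ring]
    rw [e1, ← k3, e2, hB] at k1
    rw [intervalIntegral.integral_const_mul, k1]
    simp only [sub_add_cancel, sub_self, Real.rpow_zero, one_mul]
    rw [hc]
    have := Real.pi_pos
    field_simp
  intro t ht
  obtain ⟨T, htT, hT1⟩ := exists_between ht.2
  have hT0 : 0 < T := ht.1.trans htT
  have hderiv : ∀ g : ℝ → ℝ, ContinuousOn g (Icc 0 T) →
      HasDerivAt (fun u => ∫ x in (0:ℝ)..u, g x) (g t) t := by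
    intro g hg
    have hnhds : Icc 0 T ∈ 𝓝 t := Icc_mem_nhds ht.1 htT
    refine intervalIntegral.integral_hasDerivAt_right ?_ ?_ (hg.continuousAt hnhds)
    · apply ContinuousOn.intervalIntegrable
      rw [uIcc_of_le ht.1.le]
      exact hg.mono (Icc_subset_Icc_right htT.le)
    · exact ⟨Icc 0 T, hnhds, hg.aestronglyMeasurable measurableSet_Icc⟩
  have d1 := hderiv ψ (hψc.mono (hsub T hT1))
  have d2 := hderiv (fun s => c * H s) (continuousOn_const.mul
    (aux_cont β T hβ0 hβ1 hT0 φ' (hφ'c.mono (hsub T hT1))))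
  have heq' : (fun u => ∫ x in (0:ℝ)..u, c * H x) =ᶠ[𝓝 t] fun u => ∫ x in (0:ℝ)..u, ψ x := by
    filter_upwards [Ioo_mem_nhds ht.1 ht.2] with u hu
    exact (key u hu).symm
  have := d1.unique (d2.congr_of_eventuallyEq heq'.symm)
  rw [this, hπ]
  simp only [hH, mul_comm (φ' _)]
  ring

end
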